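/- Let φ be a positive linear functional on a von Neumann algebra M that is invariant under a positive subunital map α (i.e., φ ∘ α = φ, α positive, α(1) ≤ 1). Write φ = φ_n + φ_s as the Takesaki decomposition into normal and singular parts. Then φ_n ∘ α = φ_n, i.e., the normal part is also α-invariant. (Key step: the normal part of φ_s ∘ α vanishes since (φ_s ∘ α)_n(1) ≤ 0.) -/

import Mathlib

open scoped ComplexOrder ENNReal
open MeasureTheory Filter Topology

section VN
variable {M : Type*} [NormedRing M] [StarRing M] [CStarRing M] [NormedAlgebra ℂ M]
  [PartialOrder M] [StarOrderedRing M] [CompleteSpace M]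

/-- `p` is an orthogonal projection. -/
def IsProjection (p : M) : Prop := p * p = p ∧ star p = p

/-- A continuous linear functional is positive if it is nonnegative on positive elements. -/
def IsPositiveFunctional (φ : M →L[ℂ] ℂ) : Prop := ∀ x : M, 0 ≤ x → 0 ≤ φ x

/-- A functional is normal if it is order continuous on increasing nets possessing a
least upper bound. -/
def IsNormalFunctional (φ : M →L[ℂ] ℂ) : Prop :=
  ∀ (ι : Type) [Preorder ι] (x : ι → M) (l : M), Monotone x → IsLUB (Set.range x) l →
    Filter.Tendsto (fun i => φ (x i)) Filter.atTop (nhds (φ l))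

/-- A positive functional is singular if it dominates no nonzero positive normal
functional: whenever `ψ` is positive normal with `φ - ψ ≥ 0`, then `ψ = 0`. -/
def IsSingularFunctional (φ : M →L[ℂ] ℂ) : Prop :=
  ∀ ψ : M →L[ℂ] ℂ, IsPositiveFunctional ψ → IsNormalFunctional ψ →
    IsPositiveFunctional (φ - ψ) → ψ = 0

/-- `e` is the support projection of the functional `φ`: the smallest projection with
`φ(e) = φ(1)`. -/
def IsSupportProjOf (φ : M →L[ℂ] ℂ) (e : M) : Prop :=
  IsProjection e ∧ φ e = φ 1 ∧ ∀ f : M, IsProjection f → φ f = φ 1 → e ≤ f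

/-- `s` is the support projection of the operator `x`: the smallest projection with
`s * x = x`. -/
def IsSupportOf (x s : M) : Prop :=
  IsProjection s ∧ s * x = x ∧ ∀ t : M, IsProjection t → t * x = x → s ≤ t

/-- The restriction of `φ` to the corner `rMr` is singular; characterised (Takesaki) by:
below every nonzero subprojection of `r` there is a nonzero subprojection on which `φ`
vanishes. -/
def IsSingularOnCorner (φ : M →L[ℂ] ℂ) (r : M) : Prop :=
  ∀ e : M, IsProjection e → e ≤ r → e ≠ 0 →
    ∃ f : M, IsProjection f ∧ f ≤ e ∧ f ≠ 0 ∧ φ f = 0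

end VN

section StarModule

variable {M : Type*} [NormedRing M] [StarRing M] [CStarRing M] [NormedAlgebra ℂ M]
  [PartialOrder M] [StarOrderedRing M]

/-- In a star-ordered C⋆-ring that is a complex normed algebra, the star sends the scalar `I` to
its conjugate. -/
theorem star_algebraMap_I : star (algebraMap ℂ M Complex.I) = -algebraMap ℂ M Complex.I := by
  set j := algebraMap ℂ M Complex.I with hj
  have hjj : j * j = -1 := by rw [hj, ← map_mul]; simp
  have hcomm (x : M) : j * x = x * j := Algebra.commutes _ x
  have hsj : star j * star j = -1 := by rw [← star_mul, hjj]; simp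
  set a := star j * j with ha
  have ha0 : 0 ≤ a := star_mul_self_nonneg j
  have haa : a * a = 1 := by
    calc a * a = star j * (j * star j) * j := by simp only [ha, mul_assoc]
      _ = (star j * star j) * (j * j) := by rw [hcomm]; simp only [mul_assoc]
      _ = 1 := by rw [hjj, hsj]; simp
  have hsa : star a = a := ha0.star_eq
  have hp : star (1 - a) = 1 - a := by simp [hsa]
  have h1 : 0 ≤ (1 - a) * (1 - a) := by simpa [hp] using star_mul_self_nonneg (1 - a)
  have h2 : 0 ≤ (1 - a) * a * (1 - a) := by
    simpa [hp] using star_left_conjugate_nonneg ha0 (1 - a)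
  have h3 : (1 - a) * a * (1 - a) = -((1 - a) * (1 - a)) := by
    simp only [sub_mul, mul_sub, one_mul, mul_one, haa]; abel
  have h4 : (1 - a) * (1 - a) = 0 := le_antisymm (by rwa [h3, neg_nonneg] at h2) h1
  have h5 : 1 - a = 0 := by
    rw [← CStarRing.star_mul_self_eq_zero_iff, hp, h4]
  have h6 : a = 1 := (sub_eq_zero.mp h5).symm
  calc star j = -(star j * (j * j)) := by rw [hjj]; simp
    _ = -(a * j) := by rw [ha, mul_assoc]
    _ = -j := by rw [h6, one_mul]

/-- The star is automatically conjugate-linear on a star-ordered C⋆-ring that is a complex normed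
algebra. -/
theorem starModule_complex_of_starOrderedRing : StarModule ℂ M where
  star_smul c x := by
    have hreal (r : ℝ) (x : M) : star (r • x) = r • star x :=
      map_real_smul (starAddEquiv : M ≃+ M) continuous_star r x
    have hI (x : M) : star (Complex.I • x) = -(Complex.I • star x) := by
      rw [Algebra.smul_def, star_mul, star_algebraMap_I, mul_neg, ← Algebra.commutes,
        Algebra.smul_def]
    have hc (c : ℂ) (x : M) : c • x = c.re • x + Complex.I • (c.im • x) := by
      conv_lhs => rw [← Complex.re_add_im c]
      rw [add_smul, mul_comm, mul_smul, Complex.coe_smul, Complex.coe_smul]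
    rw [hc c x, hc (star c) (star x), star_add, hI, hreal, hreal]
    simp

/-- The C⋆-algebra structure on a complete star-ordered C⋆-ring that is a complex normed
algebra. -/
@[reducible]
def cstarAlgebraOfStarOrderedRing [CompleteSpace M] : CStarAlgebra M where
  toStarModule := starModule_complex_of_starOrderedRing

end StarModule

section CStar

open scoped InnerProductSpace

variable {A : Type*} [CStarAlgebra A] [PartialOrder A]

theorem IsPositiveFunctional.add {φ ψ : A →L[ℂ] ℂ} (hφ : IsPositiveFunctional φ)
    (hψ : IsPositiveFunctional ψ) : IsPositiveFunctional (φ + ψ) :=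
  fun x hx => add_nonneg (hφ x hx) (hψ x hx)

theorem IsNormalFunctional.add {φ ψ : A →L[ℂ] ℂ} (hφ : IsNormalFunctional φ)
    (hψ : IsNormalFunctional ψ) : IsNormalFunctional (φ + ψ) :=
  fun ι _ x l hx hl => (hφ ι x l hx hl).add (hψ ι x l hx hl)

variable [StarOrderedRing A]

theorem exists_star_mul_self_of_nonneg {x : A} (hx : 0 ≤ x) : ∃ s, x = star s * s :=
  CStarAlgebra.nonneg_iff_eq_star_mul_self.mp hx

/-- A continuous positive functional as a bundled positive linear map. -/
noncomputable def IsPositiveFunctional.toPositiveLinearMap {φ : A →L[ℂ] ℂ} (h : IsPositiveFunctional φ) :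
    A →ₚ[ℂ] ℂ :=
  PositiveLinearMap.mk₀ (φ : A →ₗ[ℂ] ℂ) h

@[simp]
theorem IsPositiveFunctional.toPositiveLinearMap_apply {φ : A →L[ℂ] ℂ}
    (h : IsPositiveFunctional φ) (x : A) : h.toPositiveLinearMap x = φ x := rfl

/-- A positive functional dominated by a normal functional is normal. -/
theorem IsNormalFunctional.of_dominated {φ ψ : A →L[ℂ] ℂ} (hφ : IsNormalFunctional φ)
    (hψ : IsPositiveFunctional ψ) (hle : IsPositiveFunctional (φ - ψ)) :
    IsNormalFunctional ψ := by
  intro ι _ x l hx hl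
  have hφl : Tendsto (fun i => ‖φ (l - x i)‖) atTop (𝓝 0) := by
    simpa using ((tendsto_const_nhds (x := φ l)).sub (hφ ι x l hx hl)).norm
  have hψl : Tendsto (fun i => ψ (l - x i)) atTop (𝓝 0) := by
    refine squeeze_zero_norm (fun i => ?_) hφl
    have hi : 0 ≤ l - x i := sub_nonneg.mpr (hl.1 ⟨i, rfl⟩)
    exact CStarAlgebra.norm_le_norm_of_nonneg_of_le (hψ _ hi)
      (sub_nonneg.mp (by simpa using hle _ hi))
  simpa using (tendsto_const_nhds (x := ψ l)).sub hψl

/-- A positive functional vanishing at `1` is zero. -/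
theorem IsPositiveFunctional.eq_zero_of_apply_one {φ : A →L[ℂ] ℂ} (h : IsPositiveFunctional φ)
    (h1 : φ 1 = 0) (x : A) : φ x = 0 := by
  have hnn (y : A) (hy : 0 ≤ y) : φ y = 0 := by
    simpa [h1] using h.toPositiveLinearMap.norm_apply_le_of_nonneg y hy
  obtain ⟨y, hy, -, hxy⟩ := CStarAlgebra.exists_sum_four_nonneg x
  rw [hxy, map_sum]
  exact Finset.sum_eq_zero fun i _ => by rw [map_smul, hnn _ (hy i), smul_zero]

/-- The positive functional `(x, y) ↦ f x + g y` on `A × A`. -/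
noncomputable def PositiveLinearMap.coprodSum (f g : A →ₚ[ℂ] ℂ) : A × A →ₚ[ℂ] ℂ :=
  PositiveLinearMap.mk₀ (f.toLinearMap.coprod g.toLinearMap) fun _ hx =>
    add_nonneg (f.map_nonneg hx.1) (g.map_nonneg hx.2)

@[simp]
theorem PositiveLinearMap.coprodSum_apply (f g : A →ₚ[ℂ] ℂ) (x : A × A) :
    f.coprodSum g x = f x.1 + g x.2 := rfl

/-- If no nonzero positive functional is dominated by both `f` and `g`, then `1` can be split so
that `f` is small on one part and `g` on the other. -/
theorem PositiveLinearMap.exists_small_of_disjoint (f g : A →ₚ[ℂ] ℂ)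
    (h : ∀ ψ : A →ₚ[ℂ] ℂ, (∀ x, 0 ≤ x → ψ x ≤ f x) → (∀ x, 0 ≤ x → ψ x ≤ g x) → ψ 1 = 0)
    {ε : ℝ} (hε : 0 < ε) :
    ∃ y : A, ‖f.toPreGNS y‖ < ε ∧ ‖g.toPreGNS (y - 1)‖ < ε := by
  let F := f.coprodSum g
  let e : A × A →ₗ[ℂ] F.GNS :=
    (UniformSpace.Completion.toComplL : F.PreGNS →L[ℂ] F.GNS).toLinearMap ∘ₗ F.toPreGNS.toLinearMap
  let π : A → (F.GNS →L[ℂ] F.GNS) := fun x => F.gnsStarAlgHom (x, x)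
  have hπe (x : A) (p : A × A) : π x (e p) = e ((x, x) * p) := by
    simp [π, e]
  have hπmul (x y : A) (z : F.GNS) : π (x * y) z = π x (π y z) := by
    change F.gnsStarAlgHom ((x, x) * (y, y)) z = _
    rw [map_mul]; rfl
  have hπadj (x : A) (z w : F.GNS) : ⟪π (star x) z, w⟫_ℂ = ⟪z, π x w⟫_ℂ := by
    change ⟪F.gnsStarAlgHom (star (x, x)) z, w⟫_ℂ = _
    rw [map_star, ContinuousLinearMap.star_eq_adjoint, ContinuousLinearMap.adjoint_inner_left]
  have hnorm (p : A × A) : ((‖e p‖ ^ 2 : ℝ) : ℂ) = f (star p.1 * p.1) + g (star p.2 * p.2) := by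
    have : ‖e p‖ = ‖F.toPreGNS p‖ := UniformSpace.Completion.norm_coe _
    rw [this]
    push_cast
    rw [F.preGNS_norm_sq]
    rfl
  let K : Submodule ℂ F.GNS := (LinearMap.range (e ∘ₗ LinearMap.prod .id .id)).topologicalClosure
  have hKe (y : A) : e (y, y) ∈ K := Submodule.le_topologicalClosure _ ⟨y, rfl⟩
  have : CompleteSpace K := (Submodule.isClosed_topologicalClosure _).completeSpace_coe
  have hKinv (x : A) {z : F.GNS} (hz : z ∈ Kᗮ) : π x z ∈ Kᗮ := by
    rw [Submodule.orthogonal_closure, Submodule.mem_orthogonal]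
    rintro _ ⟨y, rfl⟩
    change ⟪e (y, y), π x z⟫_ℂ = 0
    rw [← hπadj, hπe]
    exact Submodule.inner_right_of_mem_orthogonal (hKe _) hz
  let v := e (0, 1)
  let ζ := v - K.starProjection v
  have hζ : ζ ∈ Kᗮ := K.sub_starProjection_mem_orthogonal v
  have horth (s : A) {k : F.GNS} (hk : k ∈ K) : ⟪π s ζ, π s k⟫_ℂ = 0 := by
    rw [← hπadj, ← hπmul]
    exact Submodule.inner_left_of_mem_orthogonal hk (hKinv _ hζ)
  have hsq (s : A) : ((‖π s ζ‖ ^ 2 : ℝ) : ℂ) = ⟪ζ, π (star s * s) ζ⟫_ℂ := by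
    have := hπadj (star s) ζ (π s ζ)
    rw [star_star] at this
    rw [hπmul, ← this, inner_self_eq_norm_sq_to_K]
    norm_cast
  have hinner_v (s : A) : ((‖π s ζ‖ ^ 2 : ℝ) : ℂ) = ⟪π s ζ, e (0, s)⟫_ℂ := by
    have h1 : e (0, s) = π s ζ + π s (K.starProjection v) := by
      rw [← map_add, sub_add_cancel, hπe]; simp
    rw [h1, inner_add_right, horth s (K.starProjection_apply_mem v), add_zero,
      inner_self_eq_norm_sq_to_K]
    norm_cast
  have hinner_u (s : A) : ((‖π s ζ‖ ^ 2 : ℝ) : ℂ) = -⟪π s ζ, e (s, 0)⟫_ℂ := by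
    have h1 : e (s, 0) = π s (e (1, 1)) - e (0, s) := by
      rw [hπe, ← map_sub]; simp
    rw [h1, inner_sub_right, horth s (hKe 1), hinner_v]; simp
  have hbound {a : F.GNS} {b : F.GNS} (hab : ‖a‖ ^ 2 ≤ ‖a‖ * ‖b‖) : ‖a‖ ^ 2 ≤ ‖b‖ ^ 2 := by
    nlinarith [sq_nonneg (‖a‖ - ‖b‖)]
  have hle_g (s : A) : ((‖π s ζ‖ ^ 2 : ℝ) : ℂ) ≤ g (star s * s) := by
    have h1 := hnorm (0, s)
    simp only [star_zero, mul_zero, map_zero, zero_add] at h1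
    rw [← h1, Complex.real_le_real]
    refine hbound ?_
    have := congrArg norm (hinner_v s)
    rw [Complex.norm_of_nonneg (by positivity)] at this
    exact this.trans_le (norm_inner_le_norm _ _)
  have hle_f (s : A) : ((‖π s ζ‖ ^ 2 : ℝ) : ℂ) ≤ f (star s * s) := by
    have h1 := hnorm (s, 0)
    simp only [star_zero, mul_zero, map_zero, add_zero] at h1
    rw [← h1, Complex.real_le_real]
    refine hbound ?_
    have := congrArg norm (hinner_u s)
    rw [Complex.norm_of_nonneg (by positivity), norm_neg] at this
    exact this.trans_le (norm_inner_le_norm _ _)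
  let ψ₀ : A →ₗ[ℂ] ℂ :=
    { toFun := fun x => ⟪ζ, π x ζ⟫_ℂ
      map_add' := fun x y => by
        have : π (x + y) ζ = π x ζ + π y ζ :=
          congrArg (· ζ) (map_add F.gnsStarAlgHom (x, x) (y, y))
        rw [this, inner_add_right]
      map_smul' := fun c x => by
        have : π (c • x) ζ = c • π x ζ :=
          congrArg (· ζ) (map_smul F.gnsStarAlgHom c (x, x))
        rw [this, inner_smul_right]; rfl }
  let ψ : A →ₚ[ℂ] ℂ := PositiveLinearMap.mk₀ ψ₀ fun x hx => by
    obtain ⟨s, rfl⟩ := exists_star_mul_self_of_nonneg hx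
    change 0 ≤ ⟪ζ, π (star s * s) ζ⟫_ℂ
    rw [← hsq]
    exact Complex.zero_le_real.mpr (sq_nonneg _)
  have hψ (s : A) : ψ (star s * s) = ((‖π s ζ‖ ^ 2 : ℝ) : ℂ) := (hsq s).symm
  have hψ1 : ψ 1 = 0 := by
    refine h ψ (fun x hx => ?_) (fun x hx => ?_) <;>
      obtain ⟨s, rfl⟩ := exists_star_mul_self_of_nonneg hx <;> rw [hψ]
    exacts [hle_f s, hle_g s]
  have hπ1 : π 1 ζ = ζ := by
    change F.gnsStarAlgHom 1 ζ = ζ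
    rw [map_one]; rfl
  have hζ0 : ζ = 0 := by
    have := hψ 1
    rw [star_one, one_mul, hψ1, hπ1] at this
    simpa using this.symm
  have hv : v ∈ K := by
    rw [sub_eq_zero.mp hζ0]
    exact K.starProjection_apply_mem v
  obtain ⟨_, ⟨y, rfl⟩, hy⟩ := Metric.mem_closure_iff.mp hv ε hε
  have hy' : ‖e (y, y - 1)‖ < ε := by
    have h1 : e (y, y - 1) = e (y, y) - v := by rw [← map_sub]; simp
    rw [h1, ← dist_eq_norm, dist_comm]
    exact hy
  have hsplit : ‖e (y, y - 1)‖ ^ 2 = ‖f.toPreGNS y‖ ^ 2 + ‖g.toPreGNS (y - 1)‖ ^ 2 := by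
    have h1 := hnorm (y, y - 1)
    have h2 := f.preGNS_norm_sq (f.toPreGNS y)
    have h3 := g.preGNS_norm_sq (g.toPreGNS (y - 1))
    simp only [PositiveLinearMap.ofPreGNS_toPreGNS] at h2 h3
    rw [← h2, ← h3] at h1
    exact_mod_cast h1
  refine ⟨y, ?_, ?_⟩ <;> refine lt_of_le_of_lt (abs_le_of_sq_le_sq' ?_ (norm_nonneg _)).2 hy' <;>
    nlinarith [sq_nonneg ‖f.toPreGNS y‖, sq_nonneg ‖g.toPreGNS (y - 1)‖]

theorem PositiveLinearMap.norm_toPreGNS_le {f g : A →ₚ[ℂ] ℂ} (h : ∀ x, 0 ≤ x → f x ≤ g x)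
    (x : A) : ‖f.toPreGNS x‖ ≤ ‖g.toPreGNS x‖ := by
  refine (abs_le_of_sq_le_sq' ?_ (norm_nonneg _)).2
  rw [← Complex.real_le_real]
  push_cast
  rw [f.preGNS_norm_sq, g.preGNS_norm_sq]
  exact h _ (star_mul_self_nonneg x)

/-- If `b ≤ c + d` for positive functionals and `c` is asymptotically disjoint from `b` and `d`
along a sequence, then `b ≤ d`. -/
theorem PositiveLinearMap.le_of_le_add_of_tendsto {b c d : A →ₚ[ℂ] ℂ}
    (h : ∀ x, 0 ≤ x → b x ≤ c x + d x) {y : ℕ → A}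
    (hc : Tendsto (fun k => ‖c.toPreGNS (y k)‖) atTop (𝓝 0))
    (hb : Tendsto (fun k => ‖b.toPreGNS (y k - 1)‖) atTop (𝓝 0))
    (hd : Tendsto (fun k => ‖d.toPreGNS (y k - 1)‖) atTop (𝓝 0)) {x : A} (hx : 0 ≤ x) :
    b x ≤ d x := by
  obtain ⟨s, rfl⟩ := exists_star_mul_self_of_nonneg hx
  have key (f : A →ₚ[ℂ] ℂ) (t : A)
      (hf : Tendsto (fun k => ‖f.toPreGNS (y k - t)‖) atTop (𝓝 0)) :
      Tendsto (fun k => ‖f.toPreGNS (s * y k)‖ ^ 2) atTop (𝓝 (‖f.toPreGNS (s * t)‖ ^ 2)) := by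
    have h1 : Tendsto (fun k => f.toPreGNS (y k)) atTop (𝓝 (f.toPreGNS t)) := by
      rw [tendsto_iff_norm_sub_tendsto_zero]
      simpa using hf
    exact (((f.leftMulMapPreGNS s).continuous.tendsto _).comp h1).norm.pow 2
  have hlim := ((key c 0 (by simpa using hc)).add (key d 1 hd))
  have hle := le_of_tendsto_of_tendsto' (key b 1 hb) hlim fun k => by
    rw [← Complex.real_le_real]
    push_cast
    rw [b.preGNS_norm_sq, c.preGNS_norm_sq, d.preGNS_norm_sq]
    exact h _ (star_mul_self_nonneg (s * y k))
  rw [← Complex.real_le_real] at hle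
  push_cast at hle
  rw [b.preGNS_norm_sq, c.preGNS_norm_sq, d.preGNS_norm_sq] at hle
  simpa using hle

/-- If a positive normal functional `b` is dominated by `c + d` with `c` singular and `d` positive
and normal, then `b` is dominated by `d`. -/
theorem IsSingularFunctional.le_of_le_add {b c d : A →L[ℂ] ℂ}
    (hcs : IsSingularFunctional c) (hc : IsPositiveFunctional c)
    (hb : IsPositiveFunctional b) (hbn : IsNormalFunctional b)
    (hd : IsPositiveFunctional d) (hdn : IsNormalFunctional d)
    (h : ∀ x, 0 ≤ x → b x ≤ c x + d x) : IsPositiveFunctional (d - b) := by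
  have hn := hb.add hd
  have hex (k : ℕ) := hc.toPositiveLinearMap.exists_small_of_disjoint hn.toPositiveLinearMap
    (fun ψ hψc hψn => by
      let ψ' : A →L[ℂ] ℂ := ⟨ψ.toLinearMap, map_continuous ψ⟩
      have hψ' : IsPositiveFunctional ψ' := fun x hx => ψ.map_nonneg hx
      have h0 : ψ' = 0 := hcs ψ' hψ'
        ((hbn.add hdn).of_dominated hψ' fun x hx => sub_nonneg.mpr (hψn x hx))
        fun x hx => sub_nonneg.mpr (hψc x hx)
      exact congrArg (fun θ : A →L[ℂ] ℂ => θ 1) h0)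
    (ε := 1 / ((k : ℝ) + 1)) (by positivity)
  choose y hyc hyn using hex
  have hlim := tendsto_one_div_add_atTop_nhds_zero_nat (𝕜 := ℝ)
  intro x hx
  refine sub_nonneg.mpr (PositiveLinearMap.le_of_le_add_of_tendsto
    (b := hb.toPositiveLinearMap) (c := hc.toPositiveLinearMap) (d := hd.toPositiveLinearMap)
    (y := y) h ?_ ?_ ?_ hx)
  · exact squeeze_zero (fun _ => norm_nonneg _) (fun k => (hyc k).le) hlim
  · refine squeeze_zero (fun _ => norm_nonneg _) (fun k => le_trans ?_ (hyn k).le) hlim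
    exact PositiveLinearMap.norm_toPreGNS_le
      (fun x hx => le_add_of_nonneg_right (hd x hx)) _
  · refine squeeze_zero (fun _ => norm_nonneg _) (fun k => le_trans ?_ (hyn k).le) hlim
    exact PositiveLinearMap.norm_toPreGNS_le
      (fun x hx => le_add_of_nonneg_left (hb x hx)) _

/-- The invariance of the normal part, for an arbitrary unital C⋆-algebra. -/
theorem normal_part_invariant_of_cstarAlgebra
    (α : A →L[ℂ] A) (hαpos : ∀ x : A, 0 ≤ x → 0 ≤ α x) (hαsub : α 1 ≤ 1)
    (φn φs : A →L[ℂ] ℂ)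
    (hφnpos : IsPositiveFunctional φn) (hφnnormal : IsNormalFunctional φn)
    (hαn : IsNormalFunctional (φn.comp α))
    (hφspos : IsPositiveFunctional φs) (hφssing : IsSingularFunctional φs)
    (hinv : ∀ x : A, φn (α x) + φs (α x) = φn x + φs x) (x : A) : φn (α x) = φn x := by
  have hpos : IsPositiveFunctional (φn - φn.comp α) := by
    refine hφssing.le_of_le_add hφspos (fun x hx => hφnpos _ (hαpos x hx)) hαn hφnpos hφnnormal
      fun x hx => ?_
    rw [add_comm, ← hinv x]
    exact le_add_of_nonneg_right (hφspos _ (hαpos x hx))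
  have h1 : (φn - φn.comp α) 1 = 0 := by
    refine le_antisymm ?_ (hpos 1 zero_le_one)
    have h2 : 0 ≤ φs (1 - α 1) := hφspos _ (sub_nonneg.mpr hαsub)
    have h3 : (φn - φn.comp α) 1 = -φs (1 - α 1) := by
      rw [map_sub]
      change φn 1 - φn (α 1) = _
      linear_combination -hinv 1
    rw [h3]
    exact neg_nonpos.mpr h2
  exact (sub_eq_zero.mp (hpos.eq_zero_of_apply_one h1 x)).symm

end CStar

/-- **Invariance of the normal part (Takesaki decomposition).** If `φ` is a positive
functional invariant under a normal positive subunital map `α`, and `φ = φ_n + φ_s` is its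
Takesaki decomposition into a normal part `φ_n` and a singular part `φ_s`, then the normal
part is also `α`-invariant: `φ_n ∘ α = φ_n`. -/
theorem normal_part_invariant
    {M : Type*} [NormedRing M] [StarRing M] [CStarRing M] [NormedAlgebra ℂ M]
    [PartialOrder M] [StarOrderedRing M] [CompleteSpace M]
    (α : M →L[ℂ] M)
    (hαpos : ∀ x : M, 0 ≤ x → 0 ≤ α x)
    (hαsub : α 1 ≤ 1)
    (hαnormal : ∀ ψ : M →L[ℂ] ℂ, IsNormalFunctional ψ → IsNormalFunctional (ψ.comp α))
    (φ φn φs : M →L[ℂ] ℂ)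
    (hφpos : IsPositiveFunctional φ)
    (hφnpos : IsPositiveFunctional φn) (hφnnormal : IsNormalFunctional φn)
    (hφspos : IsPositiveFunctional φs) (hφssing : IsSingularFunctional φs)
    (hdecomp : φ = φn + φs)
    (hinv : ∀ x : M, φ (α x) = φ x) :
    ∀ x : M, φn (α x) = φn x := by
  let _ : CStarAlgebra M := cstarAlgebraOfStarOrderedRing
  exact normal_part_invariant_of_cstarAlgebra α hαpos hαsub φn φs hφnpos hφnnormal
    (hαnormal φn hφnnormal) hφspos hφssing fun x => by simpa [hdecomp] using hinv x
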